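/- For the Deferred Acceptance mechanism DA and any problem θ = (P, r), the auditability index #DA^θ = 2 if and only if for every outcome ω ≠ DA(θ): either ω is not stable at θ, or ω is stable at θ and there exist two individuals i and j such that (a) ω(j) P_i ω(i) and ω(i) P_j ω(j), and (b) for every object o ∉ {ω(i), ω(j)}, either o P_i ω(i) or o P_j ω(j). -/

import Mathlib

/-! ## General auditability framework (Grigoryan–Möller, "A Theory of Auditability") -/

section Audit

variable {ι : Type*} [Fintype ι] [DecidableEq ι]
variable {Θi : ι → Type*} {Ωi : ι → Type*}

/-- A nonempty group `G` detects the deviation `ω ≠ φ θ`: for every feasible problem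
that agrees with `θ` on `G`, some member of `G` receives an outcome different from
her outcome under `ω`. -/
def Detects (ΘS : Set (∀ i, Θi i)) (φ : (∀ i, Θi i) → (∀ i, Ωi i))
    (θ : ∀ i, Θi i) (ω : ∀ i, Ωi i) (G : Finset ι) : Prop :=
  G.Nonempty ∧ ∀ θ' ∈ ΘS, (∀ i ∈ G, θ' i = θ i) → ∃ i ∈ G, ω i ≠ φ θ' i

/-- The minimal size of a group detecting the deviation `ω`. -/
noncomputable def minDetect (ΘS : Set (∀ i, Θi i)) (φ : (∀ i, Θi i) → (∀ i, Ωi i))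
    (θ : ∀ i, Θi i) (ω : ∀ i, Ωi i) : ℕ :=
  sInf {n | ∃ G : Finset ι, G.card = n ∧ Detects ΘS φ θ ω G}

/-- The auditability index `#φ^θ`: the maximum over feasible deviations `ω ≠ φ θ`
of the minimal size of a detecting group. -/
noncomputable def auditIndex (ΩS : Set (∀ i, Ωi i)) (ΘS : Set (∀ i, Θi i))
    (φ : (∀ i, Θi i) → (∀ i, Ωi i)) (θ : ∀ i, Θi i) : ℕ :=
  sSup {n | ∃ ω ∈ ΩS, ω ≠ φ θ ∧ minDetect ΘS φ θ ω = n}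

/-- The worst-case auditability index `#φ`. -/
noncomputable def worstIndex (ΩS : Set (∀ i, Ωi i)) (ΘS : Set (∀ i, Θi i))
    (φ : (∀ i, Θi i) → (∀ i, Ωi i)) : ℕ :=
  sSup {n | ∃ θ ∈ ΘS, auditIndex ΩS ΘS φ θ = n}

end Audit

/-! ## Object allocation without money -/

section ObjectAlloc

variable {N : ℕ} {Θi : Fin N → Type*}

/-- Feasible outcomes: bijections from the `N` individuals to the `N` objects. -/
def allocΩS (N : ℕ) : Set (Fin N → Fin N) := {ω | Function.Bijective ω}

/-- Object `o` is possible for individual `i` at type report `θi`. -/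
def Possible (ΘS : Set (∀ i, Θi i)) (φ : (∀ i, Θi i) → (Fin N → Fin N))
    (i : Fin N) (θi : Θi i) (o : Fin N) : Prop :=
  ∃ θ ∈ ΘS, θ i = θi ∧ φ θ i = o

/-- Individual `i` clinches object `o` from the set `avail` at type report `θi`:
`o` is the unique object in `avail` that is possible for `i` at `θi`. -/
def Clinches (ΘS : Set (∀ i, Θi i)) (φ : (∀ i, Θi i) → (Fin N → Fin N))
    (i : Fin N) (θi : Θi i) (o : Fin N) (avail : Set (Fin N)) : Prop :=
  o ∈ avail ∧ Possible ΘS φ i θi o ∧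
    ∀ o' ∈ avail, Possible ΘS φ i θi o' → o' = o

/-- `φ` has a sequential clinching implementation at `θ`: there is an order `σ` over the
individuals such that, at each step `t`, the individual `σ t` clinches her `φ θ`-assignment
from the objects still available (those not assigned in earlier steps). -/
def SeqClinching (ΘS : Set (∀ i, Θi i)) (φ : (∀ i, Θi i) → (Fin N → Fin N))
    (θ : ∀ i, Θi i) : Prop :=
  ∃ σ : Fin N → Fin N, Function.Bijective σ ∧
    ∀ t : Fin N, Clinches ΘS φ (σ t) (θ (σ t)) (φ θ (σ t))
      {o | ∀ s : Fin N, s < t → φ θ (σ s) ≠ o}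

end ObjectAlloc

/-! ## Priority-based allocation -/

section PriorityBased

variable {N : ℕ}

/-- A type report in the priority-based allocation model: a strict preference
relation over the `N` objects together with a vector of priority scores. -/
abbrev PrioReport (N : ℕ) := (Fin N → Fin N → Prop) × (Fin N → ℝ)

/-- Feasible problems: each preference is a strict total order and priority scores
are strict (no two individuals have the same score at an object). -/
def prioΘS (N : ℕ) : Set (Fin N → PrioReport N) :=
  {θ | (∀ i, IsStrictTotalOrder (Fin N) (θ i).1) ∧
       ∀ i j o, i ≠ j → (θ i).2 o ≠ (θ j).2 o}

/-- An outcome `ω` is stable at `(P, r)`: no individual prefers an object assigned to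
somebody with a lower priority score at it. -/
def StableAt (P : Fin N → Fin N → Fin N → Prop) (r : Fin N → Fin N → ℝ)
    (ω : Fin N → Fin N) : Prop :=
  ¬ ∃ i j o, P i o (ω i) ∧ ω j = o ∧ r i o > r j o

/-- `ω` is the outcome of the individual-proposing Deferred Acceptance algorithm at
`(P, r)`, formalized via the Gale–Shapley characterization: `ω` is the
individual-optimal stable outcome, i.e. the stable outcome that every individual
weakly prefers to every stable outcome. -/
def IsDAOutcome (P : Fin N → Fin N → Fin N → Prop) (r : Fin N → Fin N → ℝ)
    (ω : Fin N → Fin N) : Prop :=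
  Function.Bijective ω ∧ StableAt P r ω ∧
    ∀ ω' : Fin N → Fin N, Function.Bijective ω' → StableAt P r ω' →
      ∀ i, ω i = ω' i ∨ P i (ω i) (ω' i)

/-- The position of object `o` in the strict preference `Pi`
(`1` = most preferred). -/
noncomputable def position (Pi : Fin N → Fin N → Prop) (o : Fin N) : ℕ :=
  Set.ncard {o' | Pi o' o} + 1

/-- The three requirements on the priority-modifying map `τ` of a DA-representation:
independence of irrelevant alternatives, monotonicity, and equal treatment. -/
structure TauAdmissible (N : ℕ)
    (τ : (Fin N → PrioReport N) → (Fin N → Fin N → ℝ)) : Prop where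
  iia : ∀ θ ∈ prioΘS N, ∀ θ' ∈ prioΘS N, ∀ i j o,
    position (θ i).1 o = position (θ' i).1 o →
    position (θ j).1 o = position (θ' j).1 o →
    ((θ i).2 o > (θ j).2 o ↔ (θ' i).2 o > (θ' j).2 o) →
    (τ θ i o > τ θ j o ↔ τ θ' i o > τ θ' j o)
  mono : ∀ θ ∈ prioΘS N, ∀ θ' ∈ prioΘS N, ∀ i j o,
    position (θ' i).1 o ≤ position (θ i).1 o →
    position (θ j).1 o ≤ position (θ' j).1 o →
    ((θ i).2 o > (θ j).2 o → (θ' i).2 o > (θ' j).2 o) →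
    (τ θ i o > τ θ j o → τ θ' i o > τ θ' j o)
  equalTreatment : ∀ θ ∈ prioΘS N, ∀ i j o,
    position (θ i).1 o = position (θ j).1 o →
    (θ i).2 o > (θ j).2 o → τ θ i o > τ θ j o

/-- `φ` is DA-representable through `τ`: `τ` is admissible and, at every problem
`θ = (P, r)`, `φ θ = DA(P, τ θ)`. -/
def DARepresentable (φ : (Fin N → PrioReport N) → (Fin N → Fin N))
    (τ : (Fin N → PrioReport N) → (Fin N → Fin N → ℝ)) : Prop :=
  TauAdmissible N τ ∧
    ∀ θ ∈ prioΘS N, IsDAOutcome (fun i => (θ i).1) (τ θ) (φ θ)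

/-- The condition of Theorem 2 on deviations at a problem with preferences `P` and
(modified) priorities `rmod`: every feasible deviation `ω ≠ φθ` is either unstable at
`(P, rmod)`, or stable and there are two individuals who prefer each other's
`ω`-objects to their own and such that no other object is worse than their own
`ω`-objects for both of them. -/
def TwoDetectableCond (P : Fin N → Fin N → Fin N → Prop)
    (rmod : Fin N → Fin N → ℝ) (φθ : Fin N → Fin N) : Prop :=
  ∀ ω : Fin N → Fin N, Function.Bijective ω → ω ≠ φθ →
    ¬ StableAt P rmod ω ∨
      (StableAt P rmod ω ∧ ∃ i j, i ≠ j ∧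
        P i (ω j) (ω i) ∧ P j (ω i) (ω j) ∧
        ∀ o, o ≠ ω i → o ≠ ω j → (P i o (ω i) ∨ P j o (ω j)))

end PriorityBased

/-- The individual-optimal stable outcome leaves some object envied by nobody: otherwise the map
sending each individual to the highest-priority individual who envies her has a cycle, and
trading along its cycles produces a stable outcome that Pareto improves on it. -/
theorem IsDAOutcome.exists_not_envied {N : ℕ} (hN : 0 < N) {P : Fin N → Fin N → Fin N → Prop}
    {r : Fin N → Fin N → ℝ} (hP : ∀ i, IsStrictTotalOrder (Fin N) (P i))
    {μ : Fin N → Fin N} (hμ : IsDAOutcome P r μ) : ∃ o, ∀ k, ¬ P k o (μ k) := by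
  classical
  obtain ⟨hbij, hst, hopt⟩ := hμ
  by_contra! hall
  have htop : ∀ k, ∃ d, P d (μ k) (μ d) ∧ ∀ l, P l (μ k) (μ l) → r l (μ k) ≤ r d (μ k) := by
    intro k
    obtain ⟨e, he⟩ := hall (μ k)
    obtain ⟨d, hd, hmax⟩ := Finset.exists_max_image
      (Finset.univ.filter fun l => P l (μ k) (μ l)) (fun l => r l (μ k)) ⟨e, by simpa using he⟩
    exact ⟨d, by simpa using hd, fun l hl => hmax l (by simpa using hl)⟩
  choose f hf hfmax using htop
  have hfbij := Function.bijOn_periodicPts f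
  have hcinj : Function.Injective fun k => if k ∈ Function.periodicPts f then f k else k := by
    intro a b hab
    dsimp only at hab
    split_ifs at hab with ha hb hb
    · exact hfbij.injOn ha hb hab
    · exact absurd (hab ▸ hfbij.mapsTo ha) hb
    · exact absurd (hab ▸ hfbij.mapsTo hb) ha
    · exact hab
  let e := Equiv.ofBijective _ (Finite.injective_iff_bijective.mp hcinj)
  have he1 : ∀ k ∈ Function.periodicPts f, e k = f k := fun k hk => by simp [e, hk]
  have he2 : ∀ k ∉ Function.periodicPts f, e k = k := fun k hk => by simp [e, hk]
  have hweak : ∀ k o, P k o (μ (e.symm k)) → P k o (μ k) := by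
    intro k o h
    by_cases hk : e.symm k ∈ Function.periodicPts f
    · have hek := he1 _ hk
      rw [Equiv.apply_symm_apply] at hek
      have hfk := hf (e.symm k)
      rw [← hek] at hfk
      exact (hP k).trans _ _ _ h hfk
    · have hek := he2 _ hk
      rw [Equiv.apply_symm_apply] at hek
      rwa [← hek] at h
  have hst' : StableAt P r fun k => μ (e.symm k) := by
    rintro ⟨k, l, o, hko, hl, hr⟩
    dsimp only at hl
    have hko' := hweak k o hko
    by_cases hm : e.symm l ∈ Function.periodicPts f
    · have hel := he1 _ hm
      rw [Equiv.apply_symm_apply] at hel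
      have hle := hfmax (e.symm l) k
      rw [hl, ← hel] at hle
      exact absurd (hle hko') (not_le.mpr hr)
    · have hel := he2 _ hm
      rw [Equiv.apply_symm_apply] at hel
      rw [← hel] at hl
      exact hst ⟨k, l, o, hko', hl, hr⟩
  obtain ⟨m, n, hmn, heq⟩ := Finite.exists_ne_map_eq_of_infinite fun n => f^[n] ⟨0, hN⟩
  obtain ⟨x, hx⟩ : ∃ x, x ∈ Function.periodicPts f := by
    wlog hlt : m < n generalizing m n
    · exact this n m hmn.symm heq.symm (by omega)
    refine ⟨f^[m] ⟨0, hN⟩, Function.mk_mem_periodicPts (Nat.sub_pos_of_lt hlt) ?_⟩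
    change f^[n - m] (f^[m] _) = _
    rw [← Function.iterate_add_apply, Nat.sub_add_cancel hlt.le]
    exact heq.symm
  have hfx := hf x
  have hirr := (hP (f x)).irrefl
  have hopt' := hopt _ (hbij.comp e.symm.bijective) hst' (f x)
  simp only [Function.comp_apply, ← he1 x hx, Equiv.symm_apply_apply] at hopt' hfx hirr
  rcases hopt' with h | h
  · exact hirr _ (h ▸ hfx)
  · exact hirr _ ((hP _).trans _ _ _ h hfx)

/-- The preference that ranks `x` first, `y` second, and the other objects by index. -/
def prefTop {N : ℕ} (x y a b : Fin N) : Prop :=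
  (if a = x then 0 else if a = y then 1 else a.val + 2) <
    (if b = x then 0 else if b = y then 1 else b.val + 2)

theorem isStrictTotalOrder_prefTop {N : ℕ} (x y : Fin N) :
    IsStrictTotalOrder (Fin N) (prefTop x y) where
  irrefl _ := lt_irrefl _
  trans _ _ _ := lt_trans
  trichotomous a b h₁ h₂ := by
    unfold prefTop at h₁ h₂
    split_ifs at h₁ h₂ <;> omega

theorem not_prefTop_left {N : ℕ} (x y a : Fin N) : ¬ prefTop x y a x := by
  simp [prefTop]

theorem eq_of_prefTop_right {N : ℕ} {x y a : Fin N} (h : prefTop x y a y) : a = x := by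
  by_contra hax
  unfold prefTop at h
  split_ifs at h <;> omega

theorem prefTop_left {N : ℕ} {x a : Fin N} (y : Fin N) (h : a ≠ x) : prefTop x y x a := by
  unfold prefTop
  simp only [if_true, if_neg h]
  split_ifs <;> omega

/-- If no two members of `G` block `ω`, the other individuals can report so that each of them
receives her object under `ω`, while each member of `G` does at least as well as under `ω`. -/
theorem exists_problem_extending {N : ℕ}
    {φ : (Fin N → PrioReport N) → (Fin N → Fin N)}
    (hφ : ∀ θ ∈ prioΘS N, IsDAOutcome (fun i => (θ i).1) (fun i => (θ i).2) (φ θ))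
    (θ : Fin N → PrioReport N) (G : Finset (Fin N))
    (hP : ∀ i ∈ G, IsStrictTotalOrder (Fin N) (θ i).1)
    (hr : ∀ i ∈ G, ∀ j ∈ G, ∀ o, i ≠ j → (θ i).2 o ≠ (θ j).2 o)
    {ω : Fin N → Fin N} (hω : Function.Bijective ω)
    (hst : ∀ i ∈ G, ∀ j ∈ G, (θ i).1 (ω j) (ω i) → (θ i).2 (ω j) ≤ (θ j).2 (ω j)) :
    ∃ θ' ∈ prioΘS N, (∀ i ∈ G, θ' i = θ i) ∧ (∀ i ∉ G, φ θ' i = ω i) ∧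
      ∀ i ∈ G, φ θ' i = ω i ∨ (θ i).1 (φ θ' i) (ω i) := by
  classical
  let s : Fin N → Fin N → ℝ := fun l o => 1 + ∑ g, |(θ g).2 o| + l.val
  let θ' : Fin N → PrioReport N := fun l =>
    if l ∈ G then θ l else (prefTop (ω l) (ω l), s l)
  have hin : ∀ l ∈ G, θ' l = θ l := fun l hl => if_pos hl
  have hout : ∀ l ∉ G, θ' l = (prefTop (ω l) (ω l), s l) := fun l hl => if_neg hl
  have hlt : ∀ g l o, (θ g).2 o < s l o := by
    intro g l o
    have h1 : |(θ g).2 o| ≤ ∑ g, |(θ g).2 o| :=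
      Finset.single_le_sum (f := fun g => |(θ g).2 o|) (fun _ _ => abs_nonneg _)
        (Finset.mem_univ g)
    have h2 := le_abs_self ((θ g).2 o)
    have h3 : (0 : ℝ) ≤ (l.val : ℝ) := Nat.cast_nonneg _
    simp only [s]
    linarith
  have hmem : θ' ∈ prioΘS N := by
    refine ⟨fun i => ?_, fun i j o hij => ?_⟩
    · by_cases hi : i ∈ G
      · rw [hin i hi]; exact hP i hi
      · rw [hout i hi]; exact isStrictTotalOrder_prefTop _ _
    · by_cases hi : i ∈ G <;> by_cases hj : j ∈ G
      · rw [hin i hi, hin j hj]; exact hr i hi j hj o hij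
      · rw [hin i hi, hout j hj]; exact (hlt i j o).ne
      · rw [hout i hi, hin j hj]; exact (hlt j i o).ne'
      · rw [hout i hi, hout j hj]
        intro h
        simp only [s, add_right_inj, Nat.cast_inj] at h
        exact hij (Fin.ext h)
  have hstab : StableAt (fun i => (θ' i).1) (fun i => (θ' i).2) ω := by
    rintro ⟨i, j, _, hPi, rfl, hrij⟩
    dsimp only at hPi hrij
    by_cases hi : i ∈ G
    · rw [hin i hi] at hPi hrij
      by_cases hj : j ∈ G
      · rw [hin j hj] at hrij
        exact absurd (hst i hi j hj hPi) (not_le.mpr hrij)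
      · rw [hout j hj] at hrij
        exact lt_asymm hrij (hlt i j _)
    · rw [hout i hi] at hPi
      exact not_prefTop_left _ _ _ hPi
  have hopt : ∀ i, φ θ' i = ω i ∨ (θ' i).1 (φ θ' i) (ω i) :=
    (hφ θ' hmem).2.2 ω hω hstab
  refine ⟨θ', hmem, hin, fun i hi => ?_, fun i hi => ?_⟩
  · have h := hopt i
    rw [hout i hi] at h
    exact h.resolve_right (not_prefTop_left _ _ _)
  · have h := hopt i
    rwa [hin i hi] at h

/-- Two bijections that agree off a set have the same image of that set. -/
theorem exists_mem_eq_of_eqOn_compl {α : Type*} {μ ω : α → α} (hμ : Function.Injective μ)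
    (hω : Function.Surjective ω) {s : Finset α} (h : ∀ i ∉ s, μ i = ω i) {i : α} (hi : i ∈ s) :
    ∃ j ∈ s, μ i = ω j := by
  obtain ⟨j, hj⟩ := hω (μ i)
  refine ⟨j, ?_, hj.symm⟩
  by_contra hjs
  have hji : j = i := hμ (by rw [h j hjs, hj])
  exact hjs (hji ▸ hi)

theorem detects_univ {ι : Type*} [Fintype ι] [Nonempty ι] {Θi Ωi : ι → Type*}
    {ΘS : Set (∀ i, Θi i)} {φ : (∀ i, Θi i) → (∀ i, Ωi i)} {θ : ∀ i, Θi i}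
    {ω : ∀ i, Ωi i} (h : ω ≠ φ θ) : Detects ΘS φ θ ω Finset.univ := by
  refine ⟨Finset.univ_nonempty, fun θ' _ hθ' => ?_⟩
  obtain rfl : θ' = θ := funext fun i => hθ' i (Finset.mem_univ i)
  simpa using Function.ne_iff.mp h

section DeferredAcceptance

variable {N : ℕ} {φ : (Fin N → PrioReport N) → (Fin N → Fin N)} {θ : Fin N → PrioReport N}
  {ω : Fin N → Fin N}

theorem not_detects_singleton
    (hφ : ∀ θ ∈ prioΘS N, IsDAOutcome (fun i => (θ i).1) (fun i => (θ i).2) (φ θ))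
    (hθ : θ ∈ prioΘS N) (hω : Function.Bijective ω) (i : Fin N) :
    ¬ Detects (prioΘS N) φ θ ω {i} := by
  rintro ⟨-, hdet⟩
  obtain ⟨θ', hmem, hin, hout, -⟩ := exists_problem_extending hφ θ {i}
    (fun j _ => hθ.1 j) (fun j _ k _ o hjk => hθ.2 j k o hjk) hω
    (by simp)
  obtain ⟨j, hj, hne⟩ := hdet θ' hmem hin
  obtain ⟨k, hk, hjk⟩ := exists_mem_eq_of_eqOn_compl (hφ θ' hmem).1.1 hω.2 hout hj
  rw [Finset.mem_singleton] at hj hk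
  exact hne (by rw [hjk, hj, hk])

theorem detects_pair_of_blocking
    (hφ : ∀ θ ∈ prioΘS N, IsDAOutcome (fun i => (θ i).1) (fun i => (θ i).2) (φ θ))
    {i j : Fin N} (hP : (θ i).1 (ω j) (ω i)) (hr : (θ i).2 (ω j) > (θ j).2 (ω j)) :
    Detects (prioΘS N) φ θ ω {i, j} := by
  refine ⟨⟨i, by simp⟩, fun θ' hmem hag => ?_⟩
  by_contra! hall
  have hi := hall i (by simp)
  have hj := hall j (by simp)
  refine (hφ θ' hmem).2.1 ⟨i, j, ω j, ?_, hj.symm, ?_⟩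
  · dsimp only
    rw [hag i (by simp), ← hi]
    exact hP
  · dsimp only
    rw [hag i (by simp), hag j (by simp)]
    exact hr

theorem detects_pair_of_swap
    (hφ : ∀ θ ∈ prioΘS N, IsDAOutcome (fun i => (θ i).1) (fun i => (θ i).2) (φ θ))
    {i j : Fin N} (hi : (θ i).1 (ω j) (ω i)) (hj : (θ j).1 (ω i) (ω j))
    (hall : ∀ o, o ≠ ω i → o ≠ ω j → ((θ i).1 o (ω i) ∨ (θ j).1 o (ω j))) :
    Detects (prioΘS N) φ θ ω {i, j} := by
  refine ⟨⟨i, by simp⟩, fun θ' hmem hag => ?_⟩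
  by_contra! hcon
  have hωi := hcon i (by simp)
  have hωj := hcon j (by simp)
  obtain ⟨o, ho⟩ := (hφ θ' hmem).exists_not_envied i.pos hmem.1
  have hoi := ho i
  have hoj := ho j
  rw [hag i (by simp), ← hωi] at hoi
  rw [hag j (by simp), ← hωj] at hoj
  by_cases h1 : o = ω i
  · exact hoj (h1 ▸ hj)
  by_cases h2 : o = ω j
  · exact hoi (h2 ▸ hi)
  exact (hall o h1 h2).elim hoi hoj

theorem not_detects_pair_of_not_prefers
    (hφ : ∀ θ ∈ prioΘS N, IsDAOutcome (fun i => (θ i).1) (fun i => (θ i).2) (φ θ))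
    (hθ : θ ∈ prioΘS N) (hω : Function.Bijective ω)
    (hst : StableAt (fun i => (θ i).1) (fun i => (θ i).2) ω) {i j : Fin N} (hij : i ≠ j)
    (hi : ¬ (θ i).1 (ω j) (ω i)) : ¬ Detects (prioΘS N) φ θ ω {i, j} := by
  rintro ⟨-, hdet⟩
  obtain ⟨θ', hmem, hin, hout, hweak⟩ := exists_problem_extending hφ θ {i, j}
    (fun k _ => hθ.1 k) (fun k _ l _ o hkl => hθ.2 k l o hkl) hω
    (fun k _ l _ hP => not_lt.mp fun hr => hst ⟨k, l, ω l, hP, rfl, hr⟩)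
  have hinj := (hφ θ' hmem).1.1
  have hμi : φ θ' i = ω i := by
    obtain ⟨k, hk, hik⟩ := exists_mem_eq_of_eqOn_compl hinj hω.2 hout
      (Finset.mem_insert_self i {j})
    rcases Finset.mem_insert.mp hk with rfl | hk
    · exact hik
    · rw [Finset.mem_singleton] at hk
      subst hk
      refine (hweak i (by simp)).resolve_right fun h => hi (hik ▸ h)
  have hμj : φ θ' j = ω j := by
    obtain ⟨k, hk, hjk⟩ := exists_mem_eq_of_eqOn_compl hinj hω.2 hout
      (i := j) (by simp)
    rcases Finset.mem_insert.mp hk with rfl | hk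
    · exact absurd (hinj (hμi.trans hjk.symm)) hij
    · rw [Finset.mem_singleton] at hk
      exact hk ▸ hjk
  obtain ⟨k, hk, hne⟩ := hdet θ' hmem hin
  rcases Finset.mem_insert.mp hk with rfl | hk
  · exact hne hμi.symm
  · rw [Finset.mem_singleton] at hk
    subst hk
    exact hne hμj.symm

/-- Let `k` hold an object that is worse than their own for both `i` and `j`, rank `i`'s object
first, and have a priority at it strictly between those of `i` and `j`. Then the exchange between
`i` and `j` would be blocked by `k`. -/
theorem not_detects_pair_of_third
    (hφ : ∀ θ ∈ prioΘS N, IsDAOutcome (fun i => (θ i).1) (fun i => (θ i).2) (φ θ))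
    (hθ : θ ∈ prioΘS N) (hω : Function.Bijective ω)
    (hst : StableAt (fun i => (θ i).1) (fun i => (θ i).2) ω) {i j k : Fin N} (hij : i ≠ j)
    (hki : k ≠ i) (hkj : k ≠ j) (hj : (θ j).1 (ω i) (ω j))
    (hik : ¬ (θ i).1 (ω k) (ω i)) (hjk : ¬ (θ j).1 (ω k) (ω j)) :
    ¬ Detects (prioΘS N) φ θ ω {i, j} := by
  classical
  rintro ⟨-, hdet⟩
  have hr : (θ j).2 (ω i) < (θ i).2 (ω i) :=
    lt_of_le_of_ne (not_lt.mp fun h => hst ⟨j, i, ω i, hj, rfl, h⟩) (hθ.2 j i _ hij.symm)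
  let s : Fin N → ℝ := fun o =>
    if o = ω i then ((θ i).2 o + (θ j).2 o) / 2 else |(θ i).2 o| + |(θ j).2 o| + 1
  have hsi : s (ω i) = ((θ i).2 (ω i) + (θ j).2 (ω i)) / 2 := if_pos rfl
  have hs : ∀ o, s o ≠ (θ i).2 o ∧ s o ≠ (θ j).2 o := by
    intro o
    by_cases ho : o = ω i
    · subst ho
      rw [hsi]
      constructor <;> intro h <;> linarith
    · have h1 := le_abs_self ((θ i).2 o)
      have h2 := le_abs_self ((θ j).2 o)
      have h3 := abs_nonneg ((θ i).2 o)
      have h4 := abs_nonneg ((θ j).2 o)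
      simp only [s, if_neg ho]
      constructor <;> intro h <;> linarith
  let θ₁ := Function.update θ k (prefTop (ω i) (ω k), s)
  have hk₁ : θ₁ k = (prefTop (ω i) (ω k), s) := Function.update_self ..
  have hi₁ : θ₁ i = θ i := Function.update_of_ne hki.symm ..
  have hj₁ : θ₁ j = θ j := Function.update_of_ne hkj.symm ..
  have hblock : ∀ l m, (θ l).1 (ω m) (ω l) → (θ l).2 (ω m) ≤ (θ m).2 (ω m) :=
    fun l m hP => not_lt.mp fun h => hst ⟨l, m, ω m, hP, rfl, h⟩
  obtain ⟨θ', hmem, hin, hout, hweak⟩ := exists_problem_extending hφ θ₁ {i, j, k}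
    (by
      simp only [Finset.mem_insert, Finset.mem_singleton, forall_eq_or_imp, forall_eq, hi₁, hj₁,
        hk₁]
      exact ⟨hθ.1 i, hθ.1 j, isStrictTotalOrder_prefTop _ _⟩)
    (by
      simp only [Finset.mem_insert, Finset.mem_singleton, forall_eq_or_imp, forall_eq, hi₁, hj₁,
        hk₁]
      exact ⟨⟨fun _ h => absurd rfl h, hθ.2 i j, fun o _ => (hs o).1.symm⟩,
        ⟨hθ.2 j i, fun _ h => absurd rfl h, fun o _ => (hs o).2.symm⟩,
        fun o _ => (hs o).1, fun o _ => (hs o).2, fun _ h => absurd rfl h⟩) hω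
    (by
      simp only [Finset.mem_insert, Finset.mem_singleton, forall_eq_or_imp, forall_eq, hi₁, hj₁,
        hk₁]
      refine ⟨⟨hblock i i, hblock i j, fun h => absurd h hik⟩,
        ⟨hblock j i, hblock j j, fun h => absurd h hjk⟩, fun _ => ?_, fun h => ?_,
        fun _ => le_rfl⟩
      · rw [hsi]; linarith
      · exact absurd (hω.1 (eq_of_prefTop_right h)) hij.symm)
  obtain ⟨⟨hinj, -⟩, hst', -⟩ := hφ θ' hmem
  have hi' : θ' i = θ i := (hin i (by simp)).trans hi₁
  have hj' : θ' j = θ j := (hin j (by simp)).trans hj₁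
  have hk' : θ' k = (prefTop (ω i) (ω k), s) := (hin k (by simp)).trans hk₁
  have hwi := hweak i (by simp)
  have hwj := hweak j (by simp)
  have hcases : ∀ l ∈ ({i, j, k} : Finset (Fin N)),
      φ θ' l = ω i ∨ φ θ' l = ω j ∨ φ θ' l = ω k := by
    intro l hl
    obtain ⟨m, hm, hlm⟩ := exists_mem_eq_of_eqOn_compl hinj hω.2 hout hl
    simp only [Finset.mem_insert, Finset.mem_singleton] at hm
    rcases hm with rfl | rfl | rfl <;> simp [hlm]
  have hni : φ θ' i ≠ ω k := by
    intro h
    rw [h, hi₁] at hwi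
    exact hwi.elim (fun h => hki (hω.1 h)) hik
  have hnj : φ θ' j ≠ ω k := by
    intro h
    rw [h, hj₁] at hwj
    exact hwj.elim (fun h => hkj (hω.1 h)) hjk
  have hci := hcases i (by simp)
  have hcj := hcases j (by simp)
  have hck := hcases k (by simp)
  have hij' : φ θ' i ≠ φ θ' j := fun h => hij (hinj h)
  have hik' : φ θ' i ≠ φ θ' k := fun h => hki.symm (hinj h)
  have hjk' : φ θ' j ≠ φ θ' k := fun h => hkj.symm (hinj h)
  have hkω : φ θ' k = ω k := by grind
  have hnswap : φ θ' j ≠ ω i := by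
    intro h
    refine hst' ⟨k, j, ω i, ?_, h, ?_⟩
    · dsimp only
      rw [hk', hkω]
      exact prefTop_left _ fun h => hki (hω.1 h)
    · dsimp only
      rw [hk', hj']
      dsimp only
      rw [hsi]
      linarith
  have hμj : φ θ' j = ω j := by grind
  have hμi : φ θ' i = ω i := by grind
  obtain ⟨l, hl, hne⟩ := hdet θ' hmem (by simp [hi', hj'])
  simp only [Finset.mem_insert, Finset.mem_singleton] at hl
  rcases hl with rfl | rfl
  · exact hne hμi.symm
  · exact hne hμj.symm

theorem two_le_minDetect
    (hφ : ∀ θ ∈ prioΘS N, IsDAOutcome (fun i => (θ i).1) (fun i => (θ i).2) (φ θ))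
    (hθ : θ ∈ prioΘS N) (hω : Function.Bijective ω) (hN : 2 ≤ N) (hne : ω ≠ φ θ) :
    2 ≤ minDetect (prioΘS N) φ θ ω := by
  have : NeZero N := ⟨by omega⟩
  refine le_csInf ⟨_, Finset.univ, rfl, detects_univ hne⟩ ?_
  rintro _ ⟨G, rfl, hG⟩
  by_contra! hlt
  obtain ⟨i, rfl⟩ := Finset.card_eq_one.mp
    (le_antisymm (Nat.lt_succ_iff.mp hlt) hG.1.card_pos)
  exact not_detects_singleton hφ hθ hω i hG

theorem minDetect_le_two_iff
    (hφ : ∀ θ ∈ prioΘS N, IsDAOutcome (fun i => (θ i).1) (fun i => (θ i).2) (φ θ))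
    (hθ : θ ∈ prioΘS N) (hω : Function.Bijective ω) (hN : 2 ≤ N) (hne : ω ≠ φ θ) :
    minDetect (prioΘS N) φ θ ω ≤ 2 ↔
      ∃ i j, i ≠ j ∧ Detects (prioΘS N) φ θ ω {i, j} := by
  have : NeZero N := ⟨by omega⟩
  constructor
  · intro h
    obtain ⟨G, hcard, hG⟩ := Nat.sInf_mem
      (s := {n | ∃ G : Finset (Fin N), G.card = n ∧ Detects (prioΘS N) φ θ ω G})
      ⟨_, Finset.univ, rfl, detects_univ hne⟩
    obtain ⟨i, j, hij, rfl⟩ := Finset.card_eq_two.mp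
      (hcard.trans (le_antisymm h (two_le_minDetect hφ hθ hω hN hne)))
    exact ⟨i, j, hij, hG⟩
  · rintro ⟨i, j, hij, h⟩
    exact Nat.sInf_le ⟨_, Finset.card_pair hij, h⟩

theorem exists_detects_pair_iff
    (hφ : ∀ θ ∈ prioΘS N, IsDAOutcome (fun i => (θ i).1) (fun i => (θ i).2) (φ θ))
    (hθ : θ ∈ prioΘS N) (hω : Function.Bijective ω) :
    (∃ i j, i ≠ j ∧ Detects (prioΘS N) φ θ ω {i, j}) ↔
      ¬ StableAt (fun i => (θ i).1) (fun i => (θ i).2) ω ∨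
      (StableAt (fun i => (θ i).1) (fun i => (θ i).2) ω ∧ ∃ i j, i ≠ j ∧
        (θ i).1 (ω j) (ω i) ∧ (θ j).1 (ω i) (ω j) ∧
        ∀ o, o ≠ ω i → o ≠ ω j → ((θ i).1 o (ω i) ∨ (θ j).1 o (ω j))) := by
  constructor
  · rintro ⟨i, j, hij, hdet⟩
    by_cases hst : StableAt (fun i => (θ i).1) (fun i => (θ i).2) ω
    · refine .inr ⟨hst, i, j, hij, ?_⟩
      have hi : (θ i).1 (ω j) (ω i) := by
        by_contra h
        exact not_detects_pair_of_not_prefers hφ hθ hω hst hij h hdet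
      have hj : (θ j).1 (ω i) (ω j) := by
        by_contra h
        exact not_detects_pair_of_not_prefers hφ hθ hω hst hij.symm h
          (Finset.pair_comm i j ▸ hdet)
      refine ⟨hi, hj, fun o hoi hoj => ?_⟩
      by_contra! h
      obtain ⟨k, rfl⟩ := hω.2 o
      exact not_detects_pair_of_third hφ hθ hω hst hij (ne_of_apply_ne ω hoi)
        (ne_of_apply_ne ω hoj) hj h.1 h.2 hdet
    · exact .inl hst
  · rintro (hst | ⟨-, i, j, hij, hi, hj, hall⟩)
    · obtain ⟨i, j, _, hP, rfl, hr⟩ := not_not.mp hst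
      exact ⟨i, j, fun h => (h ▸ hr).false, detects_pair_of_blocking hφ hP hr⟩
    · exact ⟨i, j, hij, detects_pair_of_swap hφ hi hj hall⟩

end DeferredAcceptance

theorem minDetect_le_card {ι : Type*} [Fintype ι] [Nonempty ι] {Θi Ωi : ι → Type*}
    {ΘS : Set (∀ i, Θi i)} {φ : (∀ i, Θi i) → (∀ i, Ωi i)} {θ : ∀ i, Θi i}
    {ω : ∀ i, Ωi i} (h : ω ≠ φ θ) : minDetect ΘS φ θ ω ≤ Fintype.card ι :=
  Nat.sInf_le ⟨_, Finset.card_univ, detects_univ h⟩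

/-- Proposition, DA case of Theorem 2: let `φ` be the Deferred
Acceptance mechanism (at every problem `θ = (P, r)` it selects `DA(P, r)`), and let
`θ` be a problem. Then `#DA^θ = 2` iff every feasible deviation `ω ≠ DA(θ)` is either
not stable at `θ`, or stable at `θ` and there are two individuals `i, j` with
(a) `ω(j) P_i ω(i)` and `ω(i) P_j ω(j)`, and (b) every object `o ∉ {ω(i), ω(j)}`
satisfies `o P_i ω(i)` or `o P_j ω(j)`. -/
theorem statement6 {N : ℕ} (hN : 2 ≤ N)
    (φ : (Fin N → PrioReport N) → (Fin N → Fin N))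
    (hφ : ∀ θ ∈ prioΘS N, IsDAOutcome (fun i => (θ i).1) (fun i => (θ i).2) (φ θ))
    (θ : Fin N → PrioReport N) (hθ : θ ∈ prioΘS N) :
    auditIndex (allocΩS N) (prioΘS N) φ θ = 2 ↔
      TwoDetectableCond (fun i => (θ i).1) (fun i => (θ i).2) (φ θ) := by
  have : NeZero N := ⟨by omega⟩
  have key : auditIndex (allocΩS N) (prioΘS N) φ θ = 2 ↔
      ∀ ω : Fin N → Fin N, Function.Bijective ω → ω ≠ φ θ →
        minDetect (prioΘS N) φ θ ω ≤ 2 := by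
    constructor
    · intro h ω hω hne
      rw [← h]
      refine le_csSup ⟨Fintype.card (Fin N), ?_⟩ ⟨ω, hω, hne, rfl⟩
      rintro _ ⟨ω', -, hne', rfl⟩
      exact minDetect_le_card hne'
    · intro h
      obtain ⟨ω, hω, hne⟩ : ∃ ω : Fin N → Fin N, Function.Bijective ω ∧ ω ≠ φ θ := by
        let a : Fin N := ⟨0, by omega⟩
        let b : Fin N := ⟨1, by omega⟩
        have hbij := (hφ θ hθ).1
        refine ⟨φ θ ∘ Equiv.swap a b, hbij.comp (Equiv.swap a b).bijective, fun heq => ?_⟩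
        have hab := congrFun heq a
        rw [Function.comp_apply, Equiv.swap_apply_left] at hab
        simpa [a, b] using hbij.1 hab
      have hset : {n | ∃ ω ∈ allocΩS N, ω ≠ φ θ ∧ minDetect (prioΘS N) φ θ ω = n} = {2} := by
        refine Set.eq_singleton_iff_nonempty_unique_mem.mpr ⟨⟨_, ω, hω, hne, rfl⟩, ?_⟩
        rintro _ ⟨ω', hω', hne', rfl⟩
        exact le_antisymm (h ω' hω' hne') (two_le_minDetect hφ hθ hω' hN hne')
      rw [auditIndex, hset, csSup_singleton]
  rw [key]
  refine forall_congr' fun ω => forall_congr' fun hω => forall_congr' fun hne => ?_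
  rw [minDetect_le_two_iff hφ hθ hω hN hne]
  exact exists_detects_pair_iff hφ hθ hω
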